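/- Let N ≥ 2, p > 1 and 0 < ν < 1. There exists a constant C̄ > 1, depending only on N, p and ν, such that for every positive function u which is classically p-superharmonic on the annulus Ω = {x : 1/2 < ‖x‖ < 3} ⊆ EuclideanSpace ℝ (Fin N), and every point x₀ with 1 < ‖x₀‖ < 2, one has volume({ x : 1 < ‖x‖ < 2 and u(x) ≤ C̄·u(x₀) }) ≥ ν · volume({ x : 1 < ‖x‖ < 2 }). -/

import Mathlib

open MeasureTheory Filter Real Matrix
open scoped RealInnerProductSpace

/-- The vector field `F_p u (x) = ‖∇u(x)‖^(p-2) • ∇u(x)` (real power; equal to `0`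
when `∇u(x) = 0`). -/
noncomputable def pFlux (N : ℕ) (p : ℝ) (u : EuclideanSpace ℝ (Fin N) → ℝ)
    (x : EuclideanSpace ℝ (Fin N)) : EuclideanSpace ℝ (Fin N) :=
  ‖gradient u x‖ ^ (p - 2) • gradient u x

/-- The `p`-Laplacian `Δ_p u (x) = div (F_p u) (x)`. -/
noncomputable def pLaplacian (N : ℕ) (p : ℝ) (u : EuclideanSpace ℝ (Fin N) → ℝ)
    (x : EuclideanSpace ℝ (Fin N)) : ℝ :=
  ∑ i : Fin N, ⟪fderiv ℝ (pFlux N p u) x (EuclideanSpace.basisFun (Fin N) ℝ i),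
      EuclideanSpace.basisFun (Fin N) ℝ i⟫

/-- `u` is a classical supersolution of `-Δ_p u ≥ g` on `Ω`. -/
def IsPSupersolution (N : ℕ) (p : ℝ) (u : EuclideanSpace ℝ (Fin N) → ℝ)
    (g : EuclideanSpace ℝ (Fin N) → ℝ) (Ω : Set (EuclideanSpace ℝ (Fin N))) : Prop :=
  ContDiffOn ℝ 1 u Ω ∧ DifferentiableOn ℝ (pFlux N p u) Ω ∧
    ∀ x ∈ Ω, -pLaplacian N p u x ≥ g x

open scoped Topology

open scoped MatrixOrder in
theorem Matrix.PosSemidef.exists_eq_conjTranspose_mul_self {n : Type*} [Fintype n] [DecidableEq n]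
    {A : Matrix n n ℝ} (hA : A.PosSemidef) : ∃ S : Matrix n n ℝ, A = Sᴴ * S :=
  CStarAlgebra.nonneg_iff_eq_star_mul_self.1 hA.nonneg

theorem Matrix.PosSemidef.det_le_trace_div_pow {n : ℕ} (hn : n ≠ 0)
    {P : Matrix (Fin n) (Fin n) ℝ} (hP : P.PosSemidef) : P.det ≤ (P.trace / n) ^ n := by
  have h := Real.geom_mean_le_arith_mean_weighted Finset.univ (fun _ : Fin n => (n : ℝ)⁻¹)
    hP.isHermitian.eigenvalues (fun _ _ => by positivity) (by simp [hn])
    (fun i _ => hP.eigenvalues_nonneg i)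
  have hd : P.det = ∏ i, hP.isHermitian.eigenvalues i := hP.isHermitian.det_eq_prod_eigenvalues
  have ht : P.trace = ∑ i, hP.isHermitian.eigenvalues i := hP.isHermitian.trace_eq_sum_eigenvalues
  rw [Real.finsetProd_rpow _ _ (fun i _ => hP.eigenvalues_nonneg i), ← hd, ← Finset.mul_sum,
    ← ht] at h
  calc P.det = (P.det ^ ((n : ℝ)⁻¹)) ^ n := (Real.rpow_inv_natCast_pow hP.det_nonneg hn).symm
    _ ≤ _ := by
      refine pow_le_pow_left₀ (Real.rpow_nonneg hP.det_nonneg _) (h.trans_eq ?_) n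
      rw [div_eq_inv_mul]

/-- If `A * J` is positive semidefinite for some positive definite `A`, then `J` is similar to a
positive semidefinite matrix. -/
theorem Matrix.PosDef.exists_similar_of_mul {n : ℕ} {A J : Matrix (Fin n) (Fin n) ℝ}
    (hA : A.PosDef) (hAJ : (A * J).PosSemidef) :
    ∃ P : Matrix (Fin n) (Fin n) ℝ, P.PosSemidef ∧ P.det = J.det ∧ P.trace = J.trace := by
  obtain ⟨S, hS⟩ := hA.posSemidef.exists_eq_conjTranspose_mul_self
  have hSdet : IsUnit S.det := by
    have h := hA.det_pos
    rw [hS, det_mul] at h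
    exact isUnit_iff_ne_zero.2 (right_ne_zero_of_mul h.ne')
  refine ⟨S * J * S⁻¹, ?_, ?_, ?_⟩
  · have h := hAJ.conjTranspose_mul_mul_same S⁻¹
    convert h using 1
    rw [hS, ← Matrix.mul_assoc, ← Matrix.mul_assoc, ← Matrix.conjTranspose_mul,
      Matrix.mul_nonsing_inv _ hSdet]
    simp
  · rw [det_mul, det_mul, mul_right_comm, ← det_mul, Matrix.mul_nonsing_inv _ hSdet]
    simp
  · rw [Matrix.trace_mul_cycle, Matrix.nonsing_inv_mul _ hSdet, one_mul]

section InnerProductSpace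

variable {V : Type*} [NormedAddCommGroup V] [InnerProductSpace ℝ V] [FiniteDimensional ℝ V]

theorem LinearMap.IsPositive.det_trace_of_comp {n : ℕ} (b : OrthonormalBasis (Fin n) ℝ V)
    {A J : V →ₗ[ℝ] V} (hA : A.IsSymmetric) (hA' : ∀ x ≠ 0, 0 < ⟪A x, x⟫)
    (hAJ : (A ∘ₗ J).IsPositive) :
    0 ≤ LinearMap.trace ℝ V J ∧ 0 ≤ LinearMap.det J ∧
      (n ≠ 0 → LinearMap.det J ≤ (LinearMap.trace ℝ V J / n) ^ n) := by
  have hP : A.IsPositive := (LinearMap.isPositive_iff A).2 ⟨hA, fun x => by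
    rcases eq_or_ne x 0 with rfl | h
    · simp
    · exact (hA' x h).le⟩
  have hPD : (LinearMap.toMatrix b.toBasis b.toBasis A).PosDef := by
    rw [((LinearMap.posSemidef_toMatrix_iff b).2 hP).posDef_iff_isUnit]
    have hinj : Function.Injective A := by
      rw [injective_iff_map_eq_zero]
      intro x hx
      by_contra h
      simpa [hx] using hA' x h
    have hu : IsUnit A := (Module.End.isUnit_iff A).2
      ⟨hinj, (LinearMap.injective_iff_surjective).1 hinj⟩
    exact hu.map (LinearMap.toMatrixAlgEquiv b.toBasis)
  have hPJ := (LinearMap.posSemidef_toMatrix_iff b).2 hAJ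
  rw [LinearMap.toMatrix_comp b.toBasis b.toBasis b.toBasis] at hPJ
  obtain ⟨P, hP0, hdet, htr⟩ := hPD.exists_similar_of_mul hPJ
  rw [LinearMap.det_toMatrix] at hdet
  rw [← LinearMap.trace_eq_matrix_trace ℝ b.toBasis] at htr
  rw [← hdet, ← htr]
  exact ⟨hP0.trace_nonneg, hP0.det_nonneg, fun hn => hP0.det_le_trace_div_pow hn⟩

end InnerProductSpace

section InnerProductSpace

variable {V : Type*} [NormedAddCommGroup V] [InnerProductSpace ℝ V]

theorem hasFDerivAt_norm_rpow_of_ne {x : V} (hx : x ≠ 0) (s : ℝ) :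
    HasFDerivAt (fun z : V => ‖z‖ ^ s) ((s * ‖x‖ ^ (s - 2)) • innerSL ℝ x) x := by
  have hx' : 0 < ‖x‖ := norm_pos_iff.2 hx
  have h := ((hasStrictFDerivAt_norm_sq x).hasFDerivAt).rpow_const (p := s / 2)
    (Or.inl (by positivity))
  refine (h.congr_fderiv ?_).congr_of_eventuallyEq (Eventually.of_forall fun z => ?_)
  · rw [← Real.rpow_natCast, ← Real.rpow_mul hx'.le]
    ext v
    simp only [_root_.smul_apply, smul_eq_mul, nsmul_eq_mul]
    push_cast
    rw [show 2 * (s / 2 - 1) = s - 2 by ring]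
    ring
  · simp only
    rw [← Real.rpow_natCast, ← Real.rpow_mul (norm_nonneg z)]
    congr 1
    push_cast
    ring

/-- The vector field `ξ ↦ ‖ξ‖ ^ (s - 2) • ξ`, the gradient of `ξ ↦ ‖ξ‖ ^ s / s`. -/
noncomputable def powField (s : ℝ) (ξ : V) : V := ‖ξ‖ ^ (s - 2) • ξ

@[simp] theorem powField_zero (s : ℝ) : powField s (0 : V) = 0 := by simp [powField]

theorem norm_powField (s : ℝ) {ξ : V} (hξ : ξ ≠ 0) : ‖powField s ξ‖ = ‖ξ‖ ^ (s - 1) := by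
  have h : 0 < ‖ξ‖ := norm_pos_iff.2 hξ
  rw [powField, norm_smul, Real.norm_of_nonneg (by positivity)]
  conv_lhs => rw [← Real.rpow_one ‖ξ‖, ← Real.rpow_mul h.le, ← Real.rpow_add h]
  congr 1
  ring

theorem powField_powField (q s : ℝ) (ξ : V) :
    powField q (powField s ξ) = powField ((q - 1) * (s - 1) + 1) ξ := by
  rcases eq_or_ne ξ 0 with rfl | hξ
  · simp
  have h : 0 < ‖ξ‖ := norm_pos_iff.2 hξ
  rw [powField, norm_powField s hξ, powField, powField, smul_smul, ← Real.rpow_mul h.le,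
    ← Real.rpow_add h]
  congr 2
  ring

theorem powField_two (ξ : V) : powField 2 ξ = ξ := by simp [powField]

theorem powField_powField_of_conj {p q : ℝ} (h : (p - 1) * (q - 1) = 1) (ξ : V) :
    powField p (powField q ξ) = ξ := by
  rw [powField_powField, h, one_add_one_eq_two, powField_two]

theorem powField_eq_zero_iff {s : ℝ} {ξ : V} : powField s ξ = 0 ↔ ξ = 0 := by
  refine ⟨fun h => ?_, fun h => by simp [h]⟩
  by_contra hξ
  have : 0 < ‖ξ‖ := norm_pos_iff.2 hξ
  rw [powField, smul_eq_zero] at h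
  exact h.elim (by positivity) hξ

theorem powField_neg_smul (q : ℝ) {k : ℝ} (hk : 0 < k) (ξ : V) :
    powField q (-(k • ξ)) = -(k ^ (q - 1) • powField q ξ) := by
  rw [powField, powField, norm_neg, norm_smul, Real.norm_of_nonneg hk.le,
    Real.mul_rpow hk.le (norm_nonneg _), smul_neg, smul_smul, smul_smul]
  congr 2
  conv_rhs => rw [show q - 1 = (q - 2) + 1 by ring, Real.rpow_add hk, Real.rpow_one]
  ring

/-- The derivative of `powField s` at a nonzero point. -/
noncomputable def powFieldDeriv (s : ℝ) (x : V) : V →L[ℝ] V :=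
  ‖x‖ ^ (s - 2) • ContinuousLinearMap.id ℝ V +
    (((s - 2) * ‖x‖ ^ (s - 2 - 2)) • innerSL ℝ x).smulRight x

theorem powFieldDeriv_apply (s : ℝ) (x v : V) :
    powFieldDeriv s x v = ‖x‖ ^ (s - 2) • v + ((s - 2) * ‖x‖ ^ (s - 2 - 2) * ⟪x, v⟫) • x := by
  simp [powFieldDeriv]

theorem hasFDerivAt_powField {x : V} (hx : x ≠ 0) (s : ℝ) :
    HasFDerivAt (powField s) (powFieldDeriv s x) x :=
  (hasFDerivAt_norm_rpow_of_ne hx (s - 2)).smul (hasFDerivAt_id x)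

theorem isSymmetric_powFieldDeriv (s : ℝ) (x : V) :
    (powFieldDeriv s x : V →ₗ[ℝ] V).IsSymmetric := by
  intro v w
  simp only [ContinuousLinearMap.coe_coe, powFieldDeriv_apply, inner_add_left, inner_add_right,
    real_inner_smul_left, real_inner_smul_right, real_inner_comm x v]
  ring

theorem inner_powFieldDeriv_pos {s : ℝ} (hs : 1 < s) {x : V} (hx : x ≠ 0) {v : V} (hv : v ≠ 0) :
    0 < ⟪powFieldDeriv s x v, v⟫ := by
  have hx' : 0 < ‖x‖ := norm_pos_iff.2 hx
  have hv' : 0 < ‖v‖ := norm_pos_iff.2 hv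
  have hcs : ⟪x, v⟫ ^ 2 ≤ ‖x‖ ^ 2 * ‖v‖ ^ 2 := by
    rw [← mul_pow]
    exact sq_le_sq' (by linarith [neg_le_of_abs_le (abs_real_inner_le_norm x v)])
      (real_inner_le_norm x v)
  have hpow : ‖x‖ ^ (s - 2) = ‖x‖ ^ (s - 2 - 2) * ‖x‖ ^ 2 := by
    rw [← Real.rpow_natCast ‖x‖ 2, ← Real.rpow_add hx']
    congr 1
    push_cast
    ring
  have hpos : 0 < ‖x‖ ^ (s - 2 - 2) := by positivity
  have : ⟪powFieldDeriv s x v, v⟫ =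
      ‖x‖ ^ (s - 2 - 2) * (‖x‖ ^ 2 * ‖v‖ ^ 2 + (s - 2) * ⟪x, v⟫ ^ 2) := by
    rw [powFieldDeriv_apply, inner_add_left, real_inner_smul_left, real_inner_smul_left,
      real_inner_self_eq_norm_sq, hpow]
    ring
  rw [this]
  refine mul_pos hpos ?_
  have h1 : 0 < ‖x‖ ^ 2 * ‖v‖ ^ 2 := by positivity
  rcases le_total 2 s with h | h
  · nlinarith [sq_nonneg ⟪x, v⟫]
  · nlinarith

theorem trace_powFieldDeriv [FiniteDimensional ℝ V] {s : ℝ} {x : V} (hx : x ≠ 0) :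
    LinearMap.trace ℝ V (powFieldDeriv s x) =
      ‖x‖ ^ (s - 2) * (Module.finrank ℝ V + (s - 2)) := by
  have hx' : 0 < ‖x‖ := norm_pos_iff.2 hx
  have hpow : ‖x‖ ^ (s - 2) = ‖x‖ ^ (s - 2 - 2) * ‖x‖ ^ 2 := by
    rw [← Real.rpow_natCast ‖x‖ 2, ← Real.rpow_add hx']
    congr 1
    push_cast
    ring
  have h : (powFieldDeriv s x : V →ₗ[ℝ] V) = ‖x‖ ^ (s - 2) • LinearMap.id +
      (((s - 2) * ‖x‖ ^ (s - 2 - 2)) • (innerSL ℝ x : V →ₗ[ℝ] ℝ)).smulRight x := rfl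
  rw [h, map_add, map_smul, LinearMap.trace_id, LinearMap.trace_smulRight]
  simp only [LinearMap.smul_apply, ContinuousLinearMap.coe_coe, innerSL_apply_apply,
    real_inner_self_eq_norm_sq, smul_eq_mul, hpow]
  ring

/-- The derivative of the gradient is a positive operator at a local minimum. -/
theorem IsLocalMin.isPositive_fderiv_gradient [CompleteSpace V] {g : V → ℝ} {G : V → V} {x : V}
    {B : V →L[ℝ] V} (hmin : IsLocalMin g x) (hg : ∀ᶠ z in 𝓝 x, HasGradientAt g (G z) z)
    (hG : HasFDerivAt G B x) : (B : V →ₗ[ℝ] V).IsPositive := by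
  have hG0 : G x = 0 := by
    have := hmin.hasFDerivAt_eq_zero hg.self_of_nhds.hasFDerivAt
    simpa using this
  refine (LinearMap.isPositive_iff _).2 ⟨fun v w => ?_, fun v => ?_⟩
  · have h2 : HasFDerivAt (fun z => innerSL ℝ (G z)) ((innerSL ℝ).comp B) x :=
      (innerSL ℝ).hasFDerivAt.comp x hG
    have h1 : ∀ᶠ z in 𝓝 x, HasFDerivAt g (innerSL ℝ (G z)) z :=
      hg.mono fun z hz => hz.hasFDerivAt
    have := second_derivative_symmetric_of_eventually h1 h2 v w
    simp only [ContinuousLinearMap.comp_apply, innerSL_apply_apply] at this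
    simpa [real_inner_comm (B w) v] using this
  · by_contra! hneg
    have hline : ∀ t : ℝ, HasDerivAt (fun t : ℝ => x + t • v) v t := fun t => by
      simpa using ((hasDerivAt_id t).smul_const v).const_add x
    have hcont : Tendsto (fun t : ℝ => x + t • v) (𝓝 0) (𝓝 x) := by
      simpa using (hline 0).continuousAt.tendsto
    have hder : ∀ᶠ t : ℝ in 𝓝 0, HasDerivAt (fun t : ℝ => -g (x + t • v)) (-⟪G (x + t • v), v⟫) t := by
      filter_upwards [hcont.eventually hg] with t ht
      have h : HasDerivAt (fun t : ℝ => g (x + t • v)) ⟪G (x + t • v), v⟫ t := by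
        simpa [Function.comp_def] using ht.hasFDerivAt.comp_hasDerivAt t (hline t)
      exact h.fun_neg
    have hder0 : deriv (fun t : ℝ => -g (x + t • v)) =ᶠ[𝓝 0] fun t => -⟪G (x + t • v), v⟫ :=
      hder.mono fun t ht => ht.deriv
    have hB : HasDerivAt (fun t : ℝ => -⟪G (x + t • v), v⟫) (-⟪B v, v⟫) 0 := by
      have h1 : HasDerivAt (fun t : ℝ => G (x + t • v)) (B v) 0 :=
        HasFDerivAt.comp_hasDerivAt 0 (by simpa using hG) (hline 0)
      simpa using (h1.inner ℝ (hasDerivAt_const (0 : ℝ) v)).fun_neg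
    have hmax : IsLocalMin (fun t : ℝ => -g (x + t • v)) 0 := by
      refine isLocalMin_of_deriv_deriv_pos ?_ ?_ hder.self_of_nhds.continuousAt
      · rw [hder0.deriv_eq, hB.deriv]
        simpa using hneg
      · rw [hder0.self_of_nhds]
        simp [hG0]
    have hconst : (fun t : ℝ => -g (x + t • v)) =ᶠ[𝓝 0] fun _ => -g x := by
      filter_upwards [hmax, hcont.eventually hmin] with t h1 h2
      simp only [zero_smul, add_zero] at h1
      linarith
    have h0 : deriv (deriv fun t : ℝ => -g (x + t • v)) 0 = 0 := by
      rw [hconst.deriv.deriv_eq]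
      simp
    rw [hder0.deriv_eq, hB.deriv] at h0
    have : ⟪B v, v⟫ < 0 := hneg
    linarith

theorem powField_injective {q : ℝ} (hq : 1 < q) : Function.Injective (powField q : V → V) := by
  have h : (1 + (q - 1)⁻¹ - 1) * (q - 1) = 1 := by
    have : q - 1 ≠ 0 := by linarith
    field_simp
    ring
  exact Function.LeftInverse.injective (powField_powField_of_conj h)

/-- At a touching point, where `∇g` is written as `|F|^{q-2} F - |H|^{q-2} H`, the derivative of
`F - H` is similar to a positive operator. -/
theorem IsLocalMin.det_trace_fderiv_sub {n : ℕ} [FiniteDimensional ℝ V]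
    (b : OrthonormalBasis (Fin n) ℝ V) {g : V → ℝ} {F H : V → V} {x : V} {F' H' : V →L[ℝ] V}
    {q : ℝ} (hq : 1 < q) (hmin : IsLocalMin g x)
    (hg : ∀ᶠ z in 𝓝 x, HasGradientAt g (powField q (F z) - powField q (H z)) z)
    (hF : HasFDerivAt F F' x) (hH : HasFDerivAt H H' x) (h0 : H x ≠ 0) :
    0 ≤ LinearMap.trace ℝ V (F' - H' : V →L[ℝ] V) ∧ 0 ≤ (F' - H').det ∧
      (n ≠ 0 → (F' - H').det ≤ (LinearMap.trace ℝ V (F' - H' : V →L[ℝ] V) / n) ^ n) := by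
  have hFH : F x = H x := by
    have := hmin.hasFDerivAt_eq_zero hg.self_of_nhds.hasFDerivAt
    exact powField_injective hq (sub_eq_zero.1 ((LinearIsometryEquiv.map_eq_zero_iff _).1 this))
  have hB : HasFDerivAt (fun z => powField q (F z) - powField q (H z))
      ((powFieldDeriv q (H x)).comp (F' - H')) x := by
    have h1 := (hasFDerivAt_powField (hFH ▸ h0) q).comp x hF
    have h2 := (hasFDerivAt_powField h0 q).comp x hH
    rw [hFH] at h1
    rw [ContinuousLinearMap.comp_sub]
    exact h1.sub h2
  exact LinearMap.IsPositive.det_trace_of_comp b (isSymmetric_powFieldDeriv q (H x))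
    (fun v hv => inner_powFieldDeriv_pos hq h0 hv) (hmin.isPositive_fderiv_gradient hg hB)

end InnerProductSpace

section PSupersolution

variable {N : ℕ} {p q : ℝ} {u : EuclideanSpace ℝ (Fin N) → ℝ} {Ω : Set (EuclideanSpace ℝ (Fin N))}

theorem pLaplacian_eq_trace (x : EuclideanSpace ℝ (Fin N)) :
    pLaplacian N p u x = LinearMap.trace ℝ _ (fderiv ℝ (pFlux N p u) x :
      EuclideanSpace ℝ (Fin N) →ₗ[ℝ] EuclideanSpace ℝ (Fin N)) := by
  rw [LinearMap.trace_eq_sum_inner _ (EuclideanSpace.basisFun (Fin N) ℝ)]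
  simp only [pLaplacian, real_inner_comm, ContinuousLinearMap.coe_coe]

theorem IsPSupersolution.eventually_hasGradientAt
    (hu : IsPSupersolution N p u (fun _ => 0) Ω) (hΩ : IsOpen Ω) (hpq : (q - 1) * (p - 1) = 1)
    {x : EuclideanSpace ℝ (Fin N)} (hx : x ∈ Ω) :
    ∀ᶠ z in 𝓝 x, HasGradientAt u (powField q (pFlux N p u z)) z := by
  filter_upwards [hΩ.mem_nhds hx] with z hz
  have h := ((hu.1.differentiableOn one_ne_zero).differentiableAt (hΩ.mem_nhds hz)).hasGradientAt
  have e : powField q (pFlux N p u z) = gradient u z := powField_powField_of_conj hpq _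
  rwa [e]

theorem IsPSupersolution.hasFDerivAt_pFlux
    (hu : IsPSupersolution N p u (fun _ => 0) Ω) (hΩ : IsOpen Ω)
    {x : EuclideanSpace ℝ (Fin N)} (hx : x ∈ Ω) :
    HasFDerivAt (pFlux N p u) (fderiv ℝ (pFlux N p u) x) x :=
  (hu.2.1.differentiableAt (hΩ.mem_nhds hx)).hasFDerivAt

/-- A multiple of a negative power of the distance to `z₀` is a strict `p`-subsolution if the
exponent is large, hence it cannot touch a `p`-superharmonic function from below. -/
theorem IsPSupersolution.not_isLocalMin_sub_norm_rpow
    (hu : IsPSupersolution N p u (fun _ => 0) Ω) (hΩ : IsOpen Ω) (hp : 1 < p)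
    (hpq : (q - 1) * (p - 1) = 1) {z₀ x : EuclideanSpace ℝ (Fin N)} (hx : x ∈ Ω) (hxz : x ≠ z₀)
    {A : ℝ} (hA : 0 < A) :
    ¬ IsLocalMin (fun z => u z - A * ‖z - z₀‖ ^ (-(N * (q - 1) + 1))) x := by
  intro hmin
  have hq : 1 < q := by
    by_contra! h
    nlinarith
  set α : ℝ := N * (q - 1) + 1 with hα
  have hα0 : 0 < α := by
    have : 0 ≤ q - 1 := by linarith
    positivity
  set s : ℝ := 1 - (N + 2 * (p - 1)) with hs
  set k : ℝ := (A * α) ^ (p - 1) with hk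
  have hk0 : 0 < k := by positivity
  have hkq : k ^ (q - 1) = A * α := by
    rw [hk, ← Real.rpow_mul (by positivity), mul_comm (p - 1), hpq, Real.rpow_one]
  have hsub : x - z₀ ≠ 0 := sub_ne_zero.2 hxz
  have hne : ∀ᶠ z in 𝓝 x, z ≠ z₀ := isOpen_ne.mem_nhds hxz
  have hg : ∀ᶠ z in 𝓝 x, HasGradientAt (fun z => u z - A * ‖z - z₀‖ ^ (-α))
      (powField q (pFlux N p u z) - powField q (-(k • powField s (z - z₀)))) z := by
    filter_upwards [hu.eventually_hasGradientAt hΩ hpq hx, hne] with z hz hzne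
    have h1 := (hasFDerivAt_norm_rpow_of_ne (sub_ne_zero.2 hzne) (-α)).comp z
      ((hasFDerivAt_id z).sub_const z₀)
    have h2 := hz.hasFDerivAt.sub (h1.const_mul A)
    rw [hasGradientAt_iff_hasFDerivAt]
    refine h2.congr_fderiv ?_
    rw [powField_neg_smul _ hk0, hkq, powField_powField,
      show (q - 1) * (s - 1) + 1 = -α by rw [hs, hα]; linear_combination -2 * hpq,
      show powField (-α) (z - z₀) = ‖z - z₀‖ ^ (-α - 2) • (z - z₀) from rfl]
    ext v
    simp
    ring
  have hH : HasFDerivAt (fun z => -(k • powField s (z - z₀)))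
      (-(k • powFieldDeriv s (x - z₀))) x := by
    have h1 := (hasFDerivAt_powField hsub s).comp x ((hasFDerivAt_id x).sub_const z₀)
    exact (h1.const_smul k).neg
  have hH0 : -(k • powField s (x - z₀)) ≠ 0 :=
    neg_ne_zero.2 (smul_ne_zero hk0.ne' (mt powField_eq_zero_iff.1 hsub))
  have key := (hmin.det_trace_fderiv_sub (EuclideanSpace.basisFun (Fin N) ℝ) hq hg
    (hu.hasFDerivAt_pFlux hΩ hx) hH hH0).1
  have hlap := hu.2.2 x hx
  rw [pLaplacian_eq_trace] at hlap
  rw [ContinuousLinearMap.toLinearMap_sub, map_sub, ContinuousLinearMap.toLinearMap_neg,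
    ContinuousLinearMap.toLinearMap_smul, map_neg, map_smul, trace_powFieldDeriv hsub,
    finrank_euclideanSpace_fin, smul_eq_mul] at key
  have hpos : 0 < k * (‖x - z₀‖ ^ (s - 2) * (2 * (p - 1) + 1)) := by
    have : 0 < ‖x - z₀‖ := norm_pos_iff.2 hsub
    have : 0 < p - 1 := by linarith
    positivity
  have hN : (N : ℝ) + (s - 2) = -(2 * (p - 1) + 1) := by rw [hs]; ring
  rw [hN] at key
  nlinarith

/-- A positive lower bound on a ball propagates to the concentric ball of twice the radius. -/
theorem exists_forall_mul_le_closedBall_two_mul (N : ℕ) {p : ℝ} (hp : 1 < p) :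
    ∃ c : ℝ, 0 < c ∧ ∀ (u : EuclideanSpace ℝ (Fin N) → ℝ) (Ω : Set (EuclideanSpace ℝ (Fin N))),
      IsOpen Ω → (∀ x ∈ Ω, 0 < u x) → IsPSupersolution N p u (fun _ => 0) Ω →
      ∀ (z : EuclideanSpace ℝ (Fin N)) (r m : ℝ), 0 < r → 0 < m →
        Metric.closedBall z (4 * r) ⊆ Ω → (∀ x ∈ Metric.closedBall z r, m ≤ u x) →
        ∀ x ∈ Metric.closedBall z (2 * r), c * m ≤ u x := by
  have hp' : 0 < p - 1 := by linarith
  set q : ℝ := 1 + (p - 1)⁻¹ with hq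
  have hpq : (q - 1) * (p - 1) = 1 := by rw [hq]; field_simp; ring
  set α : ℝ := N * (q - 1) + 1 with hα
  have hα0 : 0 < α := by
    have : 0 < q - 1 := by rw [hq]; simpa using hp
    positivity
  refine ⟨2 ^ (-α) - 4 ^ (-α), ?_, ?_⟩
  · exact sub_pos.2 (Real.rpow_lt_rpow_of_neg (by norm_num) (by norm_num) (by linarith))
  intro u Ω hΩ hpos hu z r m hr hm hball hlow
  have hA : 0 < m * r ^ α := by positivity
  have hscale : ∀ t : ℝ, 0 < t → m * r ^ α * (t * r) ^ (-α) = m * t ^ (-α) := by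
    intro t ht
    rw [Real.mul_rpow ht.le hr.le, Real.rpow_neg hr.le]
    field_simp
  have hcomp : ∀ x ∈ Metric.closedBall z (4 * r) \ Metric.ball z r,
      -(m * 4 ^ (-α)) ≤ u x - m * r ^ α * ‖x - z‖ ^ (-α) := by
    have hK : IsCompact (Metric.closedBall z (4 * r) \ Metric.ball z r) :=
      (isCompact_closedBall z (4 * r)).diff Metric.isOpen_ball
    intro x hx
    have hcont : ContinuousOn (fun y => u y - m * r ^ α * ‖y - z‖ ^ (-α))
        (Metric.closedBall z (4 * r) \ Metric.ball z r) := by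
      refine (hu.1.continuousOn.mono (Set.sdiff_subset.trans hball)).sub
        (continuousOn_const.mul (ContinuousOn.rpow_const (by fun_prop) fun y hy => Or.inl ?_))
      have : r ≤ ‖y - z‖ := by simpa [dist_eq_norm] using hy.2
      exact (hr.trans_le this).ne'
    obtain ⟨y, hy, hymin⟩ := hK.exists_isMinOn ⟨x, hx⟩ hcont
    refine le_trans ?_ (hymin hx)
    change -(m * 4 ^ (-α)) ≤ u y - m * r ^ α * ‖y - z‖ ^ (-α)
    have hy1 : r ≤ ‖y - z‖ := by simpa [dist_eq_norm] using hy.2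
    have hy2 : ‖y - z‖ ≤ 4 * r := by simpa [dist_eq_norm] using hy.1
    rcases hy1.eq_or_lt with h1 | h1
    · have h2 := hlow y (by simp [dist_eq_norm, ← h1])
      have h3 := hscale 1 one_pos
      have : 0 < m * 4 ^ (-α) := by positivity
      simp only [one_mul, Real.one_rpow, mul_one] at h3
      rw [← h1, h3]
      linarith
    rcases hy2.eq_or_lt with h2 | h2
    · rw [h2, hscale 4 (by norm_num)]
      linarith [hpos y (hball hy.1)]
    · refine absurd (hymin.isLocalMin ?_) (hu.not_isLocalMin_sub_norm_rpow hΩ hp hpq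
        (hball hy.1) (fun h => by simp [h] at h1; linarith) hA)
      have hopen : IsOpen (Metric.ball z (4 * r) \ Metric.closedBall z r) :=
        Metric.isOpen_ball.sdiff Metric.isClosed_closedBall
      refine mem_of_superset (hopen.mem_nhds ⟨?_, ?_⟩)
        (Set.sdiff_subset_sdiff Metric.ball_subset_closedBall Metric.ball_subset_closedBall)
      · simpa [dist_eq_norm] using h2
      · simpa [dist_eq_norm] using h1
  intro x hx
  have hx2 : ‖x - z‖ ≤ 2 * r := by simpa [dist_eq_norm] using hx
  have h4 : (0 : ℝ) < 4 ^ (-α) := by positivity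
  rcases le_or_gt ‖x - z‖ r with h | h
  · have h1 := hlow x (by simpa [dist_eq_norm] using h)
    have h2 : (2 : ℝ) ^ (-α) ≤ 1 := Real.rpow_le_one_of_one_le_of_nonpos (by norm_num) (by linarith)
    nlinarith
  · have h1 := hcomp x ⟨by simp [dist_eq_norm]; linarith, by simp [dist_eq_norm]; exact h.le⟩
    have h2 : m * r ^ α * (2 * r) ^ (-α) ≤ m * r ^ α * ‖x - z‖ ^ (-α) :=
      mul_le_mul_of_nonneg_left
        (Real.rpow_le_rpow_of_nonpos (hr.trans h) hx2 (by linarith)) hA.le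
    rw [hscale 2 two_pos] at h2
    linarith

end PSupersolution

/-- A family of relations, multiplicative in its constant and holding with a fixed constant between
close points of a compact connected set, holds with a uniform constant on this set. -/
theorem IsCompact.exists_forall_rel_of_dist_le {X : Type*} [PseudoMetricSpace X] {A : Set X}
    (hA : IsCompact A) (hA' : IsPreconnected A) {R : ℝ → X → X → Prop}
    (hmono : ∀ c c' x y, c' ≤ c → R c x y → R c' x y)
    (htrans : ∀ c c' x y z, 0 < c → 0 < c' → R c x y → R c' y z → R (c * c') x z)
    {c₀ r : ℝ} (hc₀ : 0 < c₀) (hr : 0 < r)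
    (hloc : ∀ x ∈ A, ∀ y ∈ A, dist x y < r → R c₀ x y) :
    ∃ c : ℝ, 0 < c ∧ ∀ x ∈ A, ∀ y ∈ A, R c x y := by
  have hnear : ∀ x ∈ A, ∀ᶠ y in 𝓝[A] x, y ∈ A ∧ dist x y < r ∧ dist y x < r := by
    intro x _
    filter_upwards [self_mem_nhdsWithin, mem_nhdsWithin_of_mem_nhds (Metric.ball_mem_nhds x hr)]
      with y hy hyx
    exact ⟨hy, by rwa [dist_comm], hyx⟩
  have hpair : ∀ x ∈ A, ∀ y ∈ A, ∃ c : ℝ, 0 < c ∧ R c x y := by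
    intro x hx y hy
    refine hA'.induction₂' (fun x y => ∃ c : ℝ, 0 < c ∧ R c x y) ?_ ?_ hx hy
    · intro x hx
      filter_upwards [hnear x hx] with y hy
      exact ⟨⟨c₀, hc₀, hloc x hx y hy.1 hy.2.1⟩, ⟨c₀, hc₀, hloc y hy.1 x hx hy.2.2⟩⟩
    · rintro x y z - - - ⟨c, hc, h⟩ ⟨c', hc', h'⟩
      exact ⟨c * c', mul_pos hc hc', htrans c c' x y z hc hc' h h'⟩
  have hright : ∀ x ∈ A, ∃ c : ℝ, 0 < c ∧ ∀ y ∈ A, R c x y := by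
    intro x hx
    refine hA.induction_on (p := fun s => ∃ c : ℝ, 0 < c ∧ ∀ y ∈ s, R c x y)
      ⟨1, one_pos, by simp⟩ ?_ ?_ ?_
    · rintro s t hst ⟨c, hc, h⟩
      exact ⟨c, hc, fun y hy => h y (hst hy)⟩
    · rintro s t ⟨c, hc, h⟩ ⟨c', hc', h'⟩
      refine ⟨min c c', lt_min hc hc', fun y hy => hy.elim (fun hy => ?_) fun hy => ?_⟩
      · exact hmono _ _ _ _ (min_le_left _ _) (h y hy)
      · exact hmono _ _ _ _ (min_le_right _ _) (h' y hy)
    · intro y hy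
      obtain ⟨c, hc, h⟩ := hpair x hx y hy
      exact ⟨_, hnear y hy, c * c₀, mul_pos hc hc₀, fun z hz =>
        htrans _ _ _ _ _ hc hc₀ h (hloc y hy z hz.1 hz.2.1)⟩
  refine hA.induction_on (p := fun s => ∃ c : ℝ, 0 < c ∧ ∀ x ∈ s, ∀ y ∈ A, R c x y)
      ⟨1, one_pos, by simp⟩ ?_ ?_ ?_
  · rintro s t hst ⟨c, hc, h⟩
    exact ⟨c, hc, fun x hx => h x (hst hx)⟩
  · rintro s t ⟨c, hc, h⟩ ⟨c', hc', h'⟩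
    refine ⟨min c c', lt_min hc hc', fun x hx y hy => hx.elim (fun hx => ?_) fun hx => ?_⟩
    · exact hmono _ _ _ _ (min_le_left _ _) (h x hx y hy)
    · exact hmono _ _ _ _ (min_le_right _ _) (h' x hx y hy)
  · intro x hx
    obtain ⟨c, hc, h⟩ := hright x hx
    exact ⟨_, hnear x hx, c₀ * c, mul_pos hc₀ hc, fun z hz y hy =>
      htrans _ _ _ _ _ hc₀ hc (hloc z hz.1 x hx hz.2.2) (h y hy)⟩

theorem isPreconnected_setOf_norm_mem_Icc {V : Type*} [NormedAddCommGroup V] [NormedSpace ℝ V]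
    (h : 1 < Module.rank ℝ V) {a b : ℝ} (ha : 0 ≤ a) :
    IsPreconnected {x : V | a ≤ ‖x‖ ∧ ‖x‖ ≤ b} := by
  have himg : {x : V | a ≤ ‖x‖ ∧ ‖x‖ ≤ b} =
      (fun t : ℝ × V => t.1 • t.2) '' (Set.Icc a b ×ˢ Metric.sphere (0 : V) 1) := by
    ext x
    constructor
    · rintro hx
      rcases eq_or_ne x 0 with rfl | hx0
      · obtain ⟨y, hy⟩ := (isConnected_sphere h (0 : V) zero_le_one).nonempty
        exact ⟨(0, y), ⟨by simpa using hx, hy⟩, by simp⟩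
      · refine ⟨(‖x‖, ‖x‖⁻¹ • x), ⟨hx, ?_⟩, ?_⟩
        · simp [norm_smul, hx0]
        · simp [smul_smul, hx0]
    · rintro ⟨⟨t, y⟩, ⟨ht, hy⟩, rfl⟩
      have hy' : ‖y‖ = 1 := by simpa using hy
      simpa [norm_smul, hy', abs_of_nonneg (ha.trans ht.1)] using ht
  rw [himg]
  exact (isPreconnected_Icc.prod (isPreconnected_sphere h 0 1)).image _ (by fun_prop)

theorem tendsto_measure_annulus_diff_annulus {V : Type*} [NormedAddCommGroup V] [NormedSpace ℝ V]
    [MeasurableSpace V] [BorelSpace V] [FiniteDimensional ℝ V] (μ : Measure V) [μ.IsAddHaarMeasure]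
    {a b : ℝ} (ha : a ≠ 0) (hb : b ≠ 0) :
    Tendsto (fun δ : ℝ => μ ({x | a - δ < ‖x‖ ∧ ‖x‖ < b + δ} \ {x | a < ‖x‖ ∧ ‖x‖ < b}))
      (𝓝[>] 0) (𝓝 0) := by
  have hnull : μ (⋂ δ > (0 : ℝ),
      ({x : V | a - δ < ‖x‖ ∧ ‖x‖ < b + δ} \ {x | a < ‖x‖ ∧ ‖x‖ < b})) = 0 := by
    refine measure_mono_null (t := Metric.sphere (0 : V) a ∪ Metric.sphere 0 b) ?_
      (measure_union_null (Measure.addHaar_sphere_of_ne_zero μ 0 ha)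
        (Measure.addHaar_sphere_of_ne_zero μ 0 hb))
    intro x hx
    simp only [Set.mem_iInter] at hx
    have h1 : a ≤ ‖x‖ := le_of_forall_pos_lt_add fun ε hε => by linarith [(hx ε hε).1.1]
    have h2 : ‖x‖ ≤ b := le_of_forall_pos_lt_add fun ε hε => (hx ε hε).1.2
    have h3 := (hx 1 one_pos).2
    rcases h1.eq_or_lt with h | h
    · left; simp [h]
    · right
      rcases h2.eq_or_lt with h' | h'
      · simp [h']
      · exact absurd ⟨h, h'⟩ h3
  rw [← hnull]
  refine tendsto_measure_biInter_gt (fun δ _ => ?_) (fun δ δ' _ h => ?_) ⟨1, one_pos, ?_⟩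
  · have h1 : IsOpen {x : V | a - δ < ‖x‖ ∧ ‖x‖ < b + δ} :=
      (isOpen_lt continuous_const continuous_norm).inter (isOpen_lt continuous_norm continuous_const)
    have h2 : IsOpen {x : V | a < ‖x‖ ∧ ‖x‖ < b} :=
      (isOpen_lt continuous_const continuous_norm).inter (isOpen_lt continuous_norm continuous_const)
    exact (h1.measurableSet.diff h2.measurableSet).nullMeasurableSet
  · refine Set.sdiff_subset_sdiff_left fun x hx => ⟨?_, ?_⟩
    · linarith [hx.1]
    · linarith [hx.2]
  · refine ne_top_of_le_ne_top (measure_ball_lt_top (μ := μ) (x := (0 : V)) (r := b + 1)).ne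
      (measure_mono fun x hx => ?_)
    simpa using hx.1.2

section PSupersolution

variable {N : ℕ} {p q : ℝ} {u : EuclideanSpace ℝ (Fin N) → ℝ} {Ω : Set (EuclideanSpace ℝ (Fin N))}

theorem hasGradientAt_norm_sub_rpow (hq : 1 < q) (k : ℝ) (y z : EuclideanSpace ℝ (Fin N)) :
    HasGradientAt (fun z => k / q * ‖z - y‖ ^ q) (k • powField q (z - y)) z := by
  rw [hasGradientAt_iff_hasFDerivAt]
  have h := ((hasFDerivAt_norm_rpow (z - y) hq).comp z
    ((hasFDerivAt_id z).sub_const y)).const_mul (k / q)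
  refine h.congr_fderiv ?_
  rw [powField]
  ext v
  simp
  field_simp

/-- If a translate of `-(k ^ (q - 1) / q) |z - y| ^ q` touches a `p`-superharmonic function from
below at `x`, then `x + k⁻¹ F_p u(x)` is the vertex `y`, and the Jacobian determinant of this map
lies in `[0, 1]` unless `F_p u(x) = 0`. -/
theorem IsPSupersolution.add_smul_pFlux_of_isLocalMin
    (hu : IsPSupersolution N p u (fun _ => 0) Ω) (hΩ : IsOpen Ω) (hp : 1 < p) (hN : N ≠ 0)
    (hpq : (q - 1) * (p - 1) = 1) {x y : EuclideanSpace ℝ (Fin N)} (hx : x ∈ Ω) {k : ℝ}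
    (hk : 0 < k) (hmin : IsLocalMin (fun z => u z + k ^ (q - 1) / q * ‖z - y‖ ^ q) x) :
    x + k⁻¹ • pFlux N p u x = y ∧
      (pFlux N p u x ≠ 0 →
        |(fderiv ℝ (fun z => z + k⁻¹ • pFlux N p u z) x).det| ≤ 1) := by
  have hq : 1 < q := by
    by_contra! h
    nlinarith
  have hg : ∀ᶠ z in 𝓝 x, HasGradientAt (fun z => u z + k ^ (q - 1) / q * ‖z - y‖ ^ q)
      (powField q (pFlux N p u z) - powField q (-(k • (z - y)))) z := by
    filter_upwards [hu.eventually_hasGradientAt hΩ hpq hx] with z hz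
    rw [powField_neg_smul _ hk, sub_neg_eq_add, hasGradientAt_iff_hasFDerivAt, map_add]
    exact hz.hasFDerivAt.add (hasGradientAt_norm_sub_rpow hq _ y z).hasFDerivAt
  have hflux : pFlux N p u x = -(k • (x - y)) := by
    have := hmin.hasFDerivAt_eq_zero hg.self_of_nhds.hasFDerivAt
    exact powField_injective hq (sub_eq_zero.1 ((LinearIsometryEquiv.map_eq_zero_iff _).1 this))
  refine ⟨by rw [hflux, smul_neg, smul_smul, inv_mul_cancel₀ hk.ne']; simp, fun h0 => ?_⟩
  have hF := hu.hasFDerivAt_pFlux hΩ hx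
  set J := fderiv ℝ (pFlux N p u) x with hJ
  have hH : HasFDerivAt (fun z => -(k • (z - y)))
      (-(k • ContinuousLinearMap.id ℝ (EuclideanSpace ℝ (Fin N)))) x :=
    (((hasFDerivAt_id x).sub_const y).const_smul k).neg
  obtain ⟨htr0, hdet0, hdet⟩ := hmin.det_trace_fderiv_sub (EuclideanSpace.basisFun (Fin N) ℝ) hq hg
    hF hH (hflux ▸ h0)
  have hlap := hu.2.2 x hx
  rw [pLaplacian_eq_trace] at hlap
  have htr : LinearMap.trace ℝ (EuclideanSpace ℝ (Fin N))
      (J - -(k • ContinuousLinearMap.id ℝ (EuclideanSpace ℝ (Fin N))) :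
        EuclideanSpace ℝ (Fin N) →L[ℝ] EuclideanSpace ℝ (Fin N)) ≤ k * N := by
    rw [ContinuousLinearMap.toLinearMap_sub, map_sub, ContinuousLinearMap.toLinearMap_neg,
      ContinuousLinearMap.toLinearMap_smul, map_neg, map_smul, ContinuousLinearMap.coe_id,
      LinearMap.trace_id, finrank_euclideanSpace_fin, smul_eq_mul]
    linarith
  have hT : fderiv ℝ (fun z => z + k⁻¹ • pFlux N p u z) x =
      k⁻¹ • (J - -(k • ContinuousLinearMap.id ℝ (EuclideanSpace ℝ (Fin N)))) := by
    have hd : HasFDerivAt (fun z => z + k⁻¹ • pFlux N p u z)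
        (ContinuousLinearMap.id ℝ (EuclideanSpace ℝ (Fin N)) + k⁻¹ • J) x :=
      (hasFDerivAt_id x).add (hF.const_smul k⁻¹)
    rw [hd.fderiv, sub_neg_eq_add, smul_add, smul_smul, inv_mul_cancel₀ hk.ne', one_smul, add_comm]
  have hdetT : (fderiv ℝ (fun z => z + k⁻¹ • pFlux N p u z) x).det =
      k⁻¹ ^ N * (J - -(k • ContinuousLinearMap.id ℝ (EuclideanSpace ℝ (Fin N)))).det := by
    rw [hT, ContinuousLinearMap.det, ContinuousLinearMap.toLinearMap_smul, LinearMap.det_smul,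
      finrank_euclideanSpace_fin, ContinuousLinearMap.det]
  have hN' : (0 : ℝ) < N := by positivity
  rw [hdetT, abs_of_nonneg (by positivity)]
  calc _ ≤ k⁻¹ ^ N * k ^ N := by
        refine mul_le_mul_of_nonneg_left ((hdet hN).trans ?_) (by positivity)
        exact pow_le_pow_left₀ (by positivity) ((div_le_iff₀ hN').2 htr) N
    _ = 1 := by rw [← mul_pow, inv_mul_cancel₀ hk.ne', one_pow]

/-- Measure estimate: the contact points have at least the measure of the set of vertices. -/
theorem IsPSupersolution.measure_le_of_forall_exists_isLocalMin
    (hu : IsPSupersolution N p u (fun _ => 0) Ω) (hΩ : IsOpen Ω) (hp : 1 < p) (hN : N ≠ 0)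
    (hpq : (q - 1) * (p - 1) = 1) {k m : ℝ} (hk : 0 < k) {D W : Set (EuclideanSpace ℝ (Fin N))}
    (hW : IsOpen W) (hWΩ : W ⊆ Ω)
    (h : ∀ y ∈ D, ∃ x ∈ W, u x ≤ m ∧
      IsLocalMin (fun z => u z + k ^ (q - 1) / q * ‖z - y‖ ^ q) x) :
    volume D ≤ volume {x ∈ W | u x ≤ m} := by
  set T : EuclideanSpace ℝ (Fin N) → EuclideanSpace ℝ (Fin N) :=
    fun z => z + k⁻¹ • pFlux N p u z with hT
  set S := {x ∈ W | u x ≤ m} with hS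
  set S₀ := {x ∈ S | pFlux N p u x = 0} with hS₀
  set S₁ := S ∩ (W ∩ pFlux N p u ⁻¹' {0}ᶜ) ∩ {x | |(fderiv ℝ T x).det| ≤ 1} with hS₁
  have hSm : MeasurableSet S := by
    have h1 : S = W \ (W ∩ u ⁻¹' Set.Ioi m) := by
      ext x
      simp only [hS, Set.mem_ofPred_eq, Set.mem_sdiff, Set.mem_inter_iff, Set.mem_preimage,
        Set.mem_Ioi, not_and, not_lt]
      tauto
    rw [h1]
    exact hW.measurableSet.diff
      ((hu.1.continuousOn.mono hWΩ).isOpen_inter_preimage hW isOpen_Ioi).measurableSet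
  have hS₁m : MeasurableSet S₁ := by
    refine (hSm.inter ?_).inter ?_
    · exact ((hu.2.1.continuousOn.mono hWΩ).isOpen_inter_preimage hW
        isOpen_compl_singleton).measurableSet
    · exact measurableSet_le
        ((ContinuousLinearMap.continuous_det.measurable.comp (measurable_fderiv ℝ T)).abs)
        measurable_const
  have hcover : D ⊆ S₀ ∪ T '' S₁ := by
    intro y hy
    obtain ⟨x, hxW, hxm, hmin⟩ := h y hy
    obtain ⟨hTx, hdet⟩ := hu.add_smul_pFlux_of_isLocalMin hΩ hp hN hpq (hWΩ hxW) hk hmin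
    by_cases h0 : pFlux N p u x = 0
    · left
      rw [h0, smul_zero, add_zero] at hTx
      exact hTx ▸ ⟨⟨hxW, hxm⟩, h0⟩
    · exact Or.inr ⟨x, ⟨⟨⟨hxW, hxm⟩, hxW, h0⟩, hdet h0⟩, hTx⟩
  have himage : volume (T '' S₁) ≤ volume S₁ := by
    calc volume (T '' S₁) ≤ ∫⁻ x in S₁, ENNReal.ofReal |(fderiv ℝ T x).det| := by
          refine addHaar_image_le_lintegral_abs_det_fderiv volume hS₁m fun x hx => ?_
          have hd := (hu.hasFDerivAt_pFlux hΩ (hWΩ hx.1.1.1)).const_smul k⁻¹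
          exact ((hasFDerivAt_id x).add hd).differentiableAt.hasFDerivAt.hasFDerivWithinAt
      _ ≤ ∫⁻ _ in S₁, 1 := setLIntegral_mono measurable_const fun x hx => by
          rw [← ENNReal.ofReal_one]
          exact ENNReal.ofReal_le_ofReal hx.2
      _ = volume S₁ := setLIntegral_one S₁
  calc volume D ≤ volume S₀ + volume (T '' S₁) :=
        (measure_mono hcover).trans (measure_union_le _ _)
    _ ≤ volume S₀ + volume S₁ := by gcongr
    _ = volume (S₀ ∪ S₁) := (measure_union
        (Set.disjoint_left.2 fun x h0 h1 => h1.1.2.2 h0.2) hS₁m).symm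
    _ ≤ volume S := measure_mono (Set.union_subset (fun x hx => hx.1) fun x hx => hx.1.1)

end PSupersolution

theorem isOpen_annulus {V : Type*} [NormedAddCommGroup V] (a b : ℝ) :
    IsOpen {x : V | a < ‖x‖ ∧ ‖x‖ < b} :=
  (isOpen_lt continuous_const continuous_norm).inter (isOpen_lt continuous_norm continuous_const)

theorem closedBall_subset_annulus {V : Type*} [NormedAddCommGroup V] {a b a' b' r : ℝ} {y : V}
    (hy : a ≤ ‖y‖ ∧ ‖y‖ ≤ b) (ha : a' + r < a) (hb : b + r < b') :
    Metric.closedBall y r ⊆ {x : V | a' < ‖x‖ ∧ ‖x‖ < b'} := by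
  intro x hx
  rw [mem_closedBall_iff_norm] at hx
  have h1 := abs_le.1 (abs_norm_sub_norm_le x y)
  exact ⟨by linarith [h1.1], by linarith [h1.2]⟩

/-- The infimum over any small ball is controlled by the value at any other point. -/
theorem exists_forall_exists_mem_closedBall_le {N : ℕ} (hN : 2 ≤ N) {p : ℝ} (hp : 1 < p) {r : ℝ}
    (hr : 0 < r) (hr' : 8 * r < 1) :
    ∃ M : ℝ, 0 < M ∧ ∀ u : EuclideanSpace ℝ (Fin N) → ℝ,
      (∀ x : EuclideanSpace ℝ (Fin N), 1/2 < ‖x‖ → ‖x‖ < 3 → 0 < u x) →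
      IsPSupersolution N p u (fun _ => 0)
        {x : EuclideanSpace ℝ (Fin N) | 1/2 < ‖x‖ ∧ ‖x‖ < 3} →
      ∀ x₀ : EuclideanSpace ℝ (Fin N), 1 ≤ ‖x₀‖ → ‖x₀‖ ≤ 2 →
      ∀ y : EuclideanSpace ℝ (Fin N), 1 ≤ ‖y‖ → ‖y‖ ≤ 2 →
        ∃ x ∈ Metric.closedBall y r, u x ≤ M * u x₀ := by
  obtain ⟨c₀, hc₀, hdouble⟩ := exists_forall_mul_le_closedBall_two_mul N hp
  have hcompact : IsCompact {x : EuclideanSpace ℝ (Fin N) | 1 ≤ ‖x‖ ∧ ‖x‖ ≤ 2} := by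
    refine (isCompact_closedBall (0 : EuclideanSpace ℝ (Fin N)) 2).of_isClosed_subset
      ((isClosed_le continuous_const continuous_norm).inter
        (isClosed_le continuous_norm continuous_const)) fun x hx => ?_
    simpa using hx.2
  have hrank : 1 < Module.rank ℝ (EuclideanSpace ℝ (Fin N)) := by
    rw [← Module.finrank_eq_rank, finrank_euclideanSpace_fin]
    exact_mod_cast hN
  obtain ⟨c, hc, hR⟩ := hcompact.exists_forall_rel_of_dist_le
    (isPreconnected_setOf_norm_mem_Icc hrank zero_le_one)
    (R := fun c z w => ∀ u : EuclideanSpace ℝ (Fin N) → ℝ,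
      (∀ x : EuclideanSpace ℝ (Fin N), 1/2 < ‖x‖ → ‖x‖ < 3 → 0 < u x) →
      IsPSupersolution N p u (fun _ => 0)
        {x : EuclideanSpace ℝ (Fin N) | 1/2 < ‖x‖ ∧ ‖x‖ < 3} →
      ∀ m : ℝ, 0 < m → (∀ x ∈ Metric.closedBall z r, m ≤ u x) →
        ∀ x ∈ Metric.closedBall w r, c * m ≤ u x)
    (fun c c' z w hcc h u hpos hu m hm hz x hx =>
      (mul_le_mul_of_nonneg_right hcc hm.le).trans (h u hpos hu m hm hz x hx))
    (fun c c' z w v hc hc' h h' u hpos hu m hm hz x hx => by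
      have := h' u hpos hu (c * m) (mul_pos hc hm) (h u hpos hu m hm hz) x hx
      linarith)
    hc₀ hr
    (fun z hz w _ hzw u hpos hu m hm hlow x hx => by
      refine hdouble u _ (isOpen_annulus _ _) (fun x hx => hpos x hx.1 hx.2) hu z r m hr hm
        (closedBall_subset_annulus hz (by linarith) (by linarith)) hlow x ?_
      rw [Metric.mem_closedBall] at hx ⊢
      have := dist_triangle x w z
      rw [dist_comm w z] at this
      linarith)
  refine ⟨2 / c, by positivity, fun u hpos hu x₀ h1 h2 y hy1 hy2 => ?_⟩
  by_contra! hlow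
  have hx₀ : 0 < u x₀ := hpos x₀ (by linarith) (by linarith)
  have := hR y ⟨hy1, hy2⟩ x₀ ⟨h1, h2⟩ u hpos hu (2 / c * u x₀) (by positivity)
    (fun x hx => (hlow x hx).le) x₀ (Metric.mem_closedBall_self hr.le)
  rw [← mul_assoc, mul_div_cancel₀ _ hc.ne'] at this
  linarith

/-- If a function on a closed ball has a small value well inside, then adding a steep multiple of
`|z - y| ^ q` produces an interior local minimum. -/
theorem exists_isLocalMin_add_norm_sub_rpow {V : Type*} [NormedAddCommGroup V] [ProperSpace V]
    {u : V → ℝ} {y x₁ : V} {δ ρ q a m : ℝ} (hu : ContinuousOn u (Metric.closedBall y δ))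
    (hpos : ∀ x ∈ Metric.closedBall y δ, 0 < u x) (hq : 0 < q) (ha : 0 ≤ a)
    (hρδ : ρ ≤ δ) (hx₁ : x₁ ∈ Metric.closedBall y ρ) (hm : u x₁ ≤ m)
    (hsteep : m + a * ρ ^ q ≤ a * δ ^ q) :
    ∃ x ∈ Metric.closedBall y δ, u x ≤ a * δ ^ q ∧
      IsLocalMin (fun z => u z + a * ‖z - y‖ ^ q) x := by
  have hx₁δ := Metric.closedBall_subset_closedBall hρδ hx₁
  have hcont : ContinuousOn (fun z => u z + a * ‖z - y‖ ^ q) (Metric.closedBall y δ) :=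
    hu.add (continuousOn_const.mul (ContinuousOn.rpow_const (by fun_prop) fun _ _ => Or.inr hq.le))
  obtain ⟨x, hx, hmin⟩ := (isCompact_closedBall y δ).exists_isMinOn ⟨x₁, hx₁δ⟩ hcont
  have hle : u x + a * ‖x - y‖ ^ q ≤ a * δ ^ q := by
    have h1 : u x + a * ‖x - y‖ ^ q ≤ u x₁ + a * ‖x₁ - y‖ ^ q := hmin hx₁δ
    have h2 : a * ‖x₁ - y‖ ^ q ≤ a * ρ ^ q := by
      rw [mem_closedBall_iff_norm] at hx₁
      gcongr
    linarith
  have h3 : 0 ≤ a * ‖x - y‖ ^ q := by positivity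
  refine ⟨x, hx, by linarith, hmin.isLocalMin ?_⟩
  have hlt : ‖x - y‖ < δ := by
    refine lt_of_le_of_ne (mem_closedBall_iff_norm.1 hx) fun h => ?_
    rw [h] at hle
    linarith [hpos x hx]
  exact mem_of_superset (Metric.isOpen_ball.mem_nhds (mem_ball_iff_norm.2 hlt))
    Metric.ball_subset_closedBall

/-- Very weak Harnack inequality: for `N ≥ 2`, `p > 1`, `0 < ν < 1` there is `C̄ > 1`,
depending only on `N, p, ν`, such that for every positive classically `p`-superharmonic
function `u` on the annulus `{1/2 < ‖x‖ < 3}` and every `x₀` with `1 < ‖x₀‖ < 2`, the set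
`{1 < ‖x‖ < 2 : u(x) ≤ C̄ u(x₀)}` occupies at least a `ν`-fraction of the volume of the
annulus `{1 < ‖x‖ < 2}`. -/
theorem very_weak_harnack (N : ℕ) (hN : 2 ≤ N) (p : ℝ) (hp : 1 < p) (ν : ℝ)
    (hν0 : 0 < ν) (hν1 : ν < 1) :
    ∃ C : ℝ, 1 < C ∧
      ∀ u : EuclideanSpace ℝ (Fin N) → ℝ,
        (∀ x : EuclideanSpace ℝ (Fin N), 1/2 < ‖x‖ → ‖x‖ < 3 → 0 < u x) →
        IsPSupersolution N p u (fun _ => 0)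
          {x : EuclideanSpace ℝ (Fin N) | 1/2 < ‖x‖ ∧ ‖x‖ < 3} →
        ∀ x₀ : EuclideanSpace ℝ (Fin N), 1 < ‖x₀‖ → ‖x₀‖ < 2 →
          ENNReal.ofReal ν * volume {x : EuclideanSpace ℝ (Fin N) | 1 < ‖x‖ ∧ ‖x‖ < 2} ≤
            volume {x : EuclideanSpace ℝ (Fin N) |
              (1 < ‖x‖ ∧ ‖x‖ < 2) ∧ u x ≤ C * u x₀} := by
  have : Nonempty (Fin N) := ⟨⟨0, by omega⟩⟩
  have hN0 : N ≠ 0 := by omega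
  set D := {x : EuclideanSpace ℝ (Fin N) | 1 < ‖x‖ ∧ ‖x‖ < 2} with hD
  have hDpos : 0 < volume D := by
    obtain ⟨x, hx⟩ := exists_norm_eq (EuclideanSpace ℝ (Fin N)) (show (0 : ℝ) ≤ 3 / 2 by norm_num)
    exact (isOpen_annulus 1 2).measure_pos volume ⟨x, by rw [hx]; norm_num, by rw [hx]; norm_num⟩
  have hDfin : volume D ≠ ⊤ := by
    refine ne_top_of_le_ne_top (measure_ball_lt_top (μ := volume)
      (x := (0 : EuclideanSpace ℝ (Fin N))) (r := 2)).ne (measure_mono fun x hx => ?_)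
    simpa using hx.2
  obtain ⟨δ, hδ, hδ8, hδ0⟩ : ∃ δ : ℝ,
      volume ({x : EuclideanSpace ℝ (Fin N) | 1 - δ < ‖x‖ ∧ ‖x‖ < 2 + δ} \ D) <
        ENNReal.ofReal (1 - ν) * volume D ∧ δ < 1 / 8 ∧ 0 < δ := by
    have h1 := (tendsto_measure_annulus_diff_annulus
      (volume : Measure (EuclideanSpace ℝ (Fin N))) one_ne_zero two_ne_zero).eventually_lt_const
      (ENNReal.mul_pos (ENNReal.ofReal_pos.2 (sub_pos.2 hν1)).ne' hDpos.ne')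
    have h2 : ∀ᶠ δ : ℝ in 𝓝[>] 0, δ < 1 / 8 :=
      mem_nhdsWithin_of_mem_nhds (gt_mem_nhds (by norm_num))
    exact (h1.and (h2.and self_mem_nhdsWithin)).exists
  obtain ⟨M, hM, hlow⟩ := exists_forall_exists_mem_closedBall_le hN hp (half_pos hδ0)
    (by linarith)
  have hp' : 0 < p - 1 := by linarith
  set q : ℝ := 1 + (p - 1)⁻¹ with hqdef
  have hpq : (q - 1) * (p - 1) = 1 := by rw [hqdef]; field_simp; ring
  have hq : 0 < q := by positivity
  set d : ℝ := δ ^ q - (δ / 2) ^ q with hd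
  have hd0 : 0 < d := sub_pos.2 (Real.rpow_lt_rpow (by positivity) (by linarith) hq)
  refine ⟨max 2 (M / d * δ ^ q), lt_max_of_lt_left one_lt_two, fun u hpos hu x₀ h1 h2 => ?_⟩
  have hu₀ : 0 < u x₀ := hpos x₀ (by linarith) (by linarith)
  set a : ℝ := M * u x₀ / d with ha
  have ha0 : 0 < a := by positivity
  set k : ℝ := (a * q) ^ (p - 1) with hk
  have hk0 : 0 < k := by positivity
  have hkq : k ^ (q - 1) / q = a := by
    rw [hk, ← Real.rpow_mul (by positivity), mul_comm (p - 1), hpq, Real.rpow_one]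
    field_simp
  set m : ℝ := a * δ ^ q with hm
  set W := {x : EuclideanSpace ℝ (Fin N) | 1 - δ < ‖x‖ ∧ ‖x‖ < 2 + δ} with hW
  have hWΩ : W ⊆ {x : EuclideanSpace ℝ (Fin N) | 1/2 < ‖x‖ ∧ ‖x‖ < 3} :=
    fun x hx => ⟨by linarith [hx.1], by linarith [hx.2]⟩
  have hball : ∀ y ∈ D, Metric.closedBall y δ ⊆ W := by
    intro y hy x hx
    rw [mem_closedBall_iff_norm] at hx
    have h3 := abs_le.1 (abs_norm_sub_norm_le x y)
    exact ⟨by linarith [h3.1, hy.1], by linarith [h3.2, hy.2]⟩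
  have hmeas : volume D ≤ volume {x ∈ W | u x ≤ m} := by
    refine hu.measure_le_of_forall_exists_isLocalMin (isOpen_annulus _ _) hp hN0 hpq hk0
      (isOpen_annulus _ _) hWΩ fun y hy => ?_
    obtain ⟨x₁, hx₁, hux₁⟩ := hlow u hpos hu x₀ h1.le h2.le y hy.1.le hy.2.le
    obtain ⟨x, hx, hxm, hmin⟩ := exists_isLocalMin_add_norm_sub_rpow (a := a)
      (hu.1.continuousOn.mono ((hball y hy).trans hWΩ))
      (fun x hx => hpos x (hWΩ (hball y hy hx)).1 (hWΩ (hball y hy hx)).2) hq ha0.le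
      (by linarith) hx₁ hux₁ (by
        have : a * d = M * u x₀ := div_mul_cancel₀ _ hd0.ne'
        rw [hd, mul_sub] at this
        linarith)
    exact ⟨x, hball y hy hx, hxm, by rwa [hkq]⟩
  have hmC : m ≤ max 2 (M / d * δ ^ q) * u x₀ := by
    refine le_trans (le_of_eq ?_) (mul_le_mul_of_nonneg_right (le_max_right _ _) hu₀.le)
    rw [hm, ha]
    ring
  have hsub : {x ∈ W | u x ≤ m} ⊆ {x | x ∈ D ∧ u x ≤ max 2 (M / d * δ ^ q) * u x₀} ∪ (W \ D) := by
    intro x hx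
    by_cases hxD : x ∈ D
    · exact Or.inl ⟨hxD, hx.2.trans hmC⟩
    · exact Or.inr ⟨hx.1, hxD⟩
  have hsum : ENNReal.ofReal ν * volume D + ENNReal.ofReal (1 - ν) * volume D = volume D := by
    rw [← add_mul, ← ENNReal.ofReal_add hν0.le (by linarith), add_sub_cancel, ENNReal.ofReal_one,
      one_mul]
  have hfin : ENNReal.ofReal (1 - ν) * volume D ≠ ⊤ := ENNReal.mul_ne_top ENNReal.ofReal_ne_top hDfin
  refine (ENNReal.add_le_add_iff_right hfin).1 ?_
  rw [hsum]
  exact (hmeas.trans ((measure_mono hsub).trans (measure_union_le _ _))).trans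
    (add_le_add le_rfl hδ.le)
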